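/- Let l ≥ 3 be an integer and ρ > 0. If g : (0,∞) → ℂ is four times differentiable, satisfies (T_l^2 g)(r) = i ρ^4 g(r) for all r > 0, and is square integrable on (0,∞), then g is identically zero. (Hence for l ≥ 3 the operator T_l^2 has deficiency indices (0,0).) -/

import Mathlib

open Set MeasureTheory

/-- The second-order differential operation
`(T_l u)(r) = -u''(r) + l(l+1) u(r)/r^2` on `(0,∞)`. -/
noncomputable def Tl (l : ℕ) (u : ℝ → ℂ) : ℝ → ℂ :=
  fun r => -(deriv (deriv u) r) + ((l : ℂ) * ((l : ℂ) + 1)) * u r / (r : ℂ) ^ 2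

/-- `h` solves `T_l h = ν h` on `(0,∞)` and `h₁` is its derivative. -/
def IsEigenPair (l : ℕ) (ν : ℂ) (h h₁ : ℝ → ℂ) : Prop :=
  ∀ r : ℝ, 0 < r → HasDerivAt h (h₁ r) r ∧
    HasDerivAt h₁ (((l : ℂ) * ((l : ℂ) + 1) / (r : ℂ) ^ 2 - ν) * h r) r

/-- Smooth transition from `0` to `1` on `[0,1]`, flat to third order at both ends, together with
its first four derivatives and a common bound for them. -/
lemma exists_smooth_step : ∃ (p₀ p₁ p₂ p₃ p₄ : ℝ → ℂ) (P : ℝ),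
    (∀ t, HasDerivAt p₀ (p₁ t) t) ∧ (∀ t, HasDerivAt p₁ (p₂ t) t) ∧
    (∀ t, HasDerivAt p₂ (p₃ t) t) ∧ (∀ t, HasDerivAt p₃ (p₄ t) t) ∧ Continuous p₄ ∧
    (p₀ 0 = 0 ∧ p₁ 0 = 0 ∧ p₂ 0 = 0 ∧ p₃ 0 = 0) ∧
    (p₀ 1 = 1 ∧ p₁ 1 = 0 ∧ p₂ 1 = 0 ∧ p₃ 1 = 0) ∧ 0 ≤ P ∧
    ∀ t ∈ Icc (0 : ℝ) 1, ‖p₁ t‖ ≤ P ∧ ‖p₂ t‖ ≤ P ∧ ‖p₃ t‖ ≤ P ∧ ‖p₄ t‖ ≤ P := by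
  have hpow : ∀ (n : ℕ) (c : ℂ) (t : ℝ),
      HasDerivAt (fun t : ℝ => c * (t : ℂ) ^ n) (c * (n * (t : ℂ) ^ (n - 1))) t := by
    intro n c t
    exact (((hasDerivAt_pow n (t : ℂ)).comp_ofReal).const_mul c)
  let p₁ : ℝ → ℂ := fun t => 140 * (t : ℂ) ^ 3 + -420 * (t : ℂ) ^ 4 + 420 * (t : ℂ) ^ 5
    + -140 * (t : ℂ) ^ 6
  let p₂ : ℝ → ℂ := fun t => 420 * (t : ℂ) ^ 2 + -1680 * (t : ℂ) ^ 3 + 2100 * (t : ℂ) ^ 4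
    + -840 * (t : ℂ) ^ 5
  let p₃ : ℝ → ℂ := fun t => 840 * (t : ℂ) ^ 1 + -5040 * (t : ℂ) ^ 2 + 8400 * (t : ℂ) ^ 3
    + -4200 * (t : ℂ) ^ 4
  let p₄ : ℝ → ℂ := fun t => 840 + -10080 * (t : ℂ) ^ 1 + 25200 * (t : ℂ) ^ 2
    + -16800 * (t : ℂ) ^ 3
  have hb : ∀ p : ℝ → ℂ, Continuous p → ∃ C, ∀ t ∈ Icc (0 : ℝ) 1, ‖p t‖ ≤ C := fun p hp =>
    isCompact_Icc.exists_bound_of_continuousOn hp.continuousOn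
  have c₁ : Continuous p₁ := by fun_prop
  have c₂ : Continuous p₂ := by fun_prop
  have c₃ : Continuous p₃ := by fun_prop
  have c₄ : Continuous p₄ := by fun_prop
  obtain ⟨C₁, h₁⟩ := hb p₁ c₁
  obtain ⟨C₂, h₂⟩ := hb p₂ c₂
  obtain ⟨C₃, h₃⟩ := hb p₃ c₃
  obtain ⟨C₄, h₄⟩ := hb p₄ c₄
  have n₁ := (norm_nonneg _).trans (h₁ 0 (by simp))
  have n₂ := (norm_nonneg _).trans (h₂ 0 (by simp))
  have n₃ := (norm_nonneg _).trans (h₃ 0 (by simp))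
  have n₄ := (norm_nonneg _).trans (h₄ 0 (by simp))
  refine ⟨fun t => 35 * (t : ℂ) ^ 4 + -84 * (t : ℂ) ^ 5 + 70 * (t : ℂ) ^ 6 + -20 * (t : ℂ) ^ 7,
    p₁, p₂, p₃, p₄, C₁ + C₂ + C₃ + C₄, ?_, ?_, ?_, ?_, c₄, ?_, ?_, by positivity, ?_⟩
  · intro t
    refine HasDerivAt.congr_deriv
      ((((hpow 4 35 t).add (hpow 5 (-84) t)).add (hpow 6 70 t)).add (hpow 7 (-20) t)) ?_
    simp only [p₁]; push_cast; ring
  · intro t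
    refine HasDerivAt.congr_deriv
      ((((hpow 3 140 t).add (hpow 4 (-420) t)).add (hpow 5 420 t)).add (hpow 6 (-140) t)) ?_
    simp only [p₂]; push_cast; ring
  · intro t
    refine HasDerivAt.congr_deriv
      ((((hpow 2 420 t).add (hpow 3 (-1680) t)).add (hpow 4 2100 t)).add (hpow 5 (-840) t)) ?_
    simp only [p₃]; push_cast; ring
  · intro t
    refine HasDerivAt.congr_deriv
      ((((hpow 1 840 t).add (hpow 2 (-5040) t)).add (hpow 3 8400 t)).add (hpow 4 (-4200) t)) ?_
    simp only [p₄]; push_cast; ring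
  · simp [p₁, p₂, p₃]
  · norm_num [p₁, p₂, p₃]
  · intro t ht
    have := h₁ t ht; have := h₂ t ht; have := h₃ t ht; have := h₄ t ht
    refine ⟨?_, ?_, ?_, ?_⟩ <;> linarith

/-- The ladder step: `-h' + (l+1) h / r` carries solutions for `l` to solutions for `l+1`. -/
lemma IsEigenPair.raise {l : ℕ} {ν : ℂ} {h h₁ : ℝ → ℂ} (H : IsEigenPair l ν h h₁) :
    IsEigenPair (l + 1) ν (fun r => -h₁ r + ((l : ℂ) + 1) / r * h r)
      (fun r => ν * h r - ((l : ℂ) + 1) / r * (-h₁ r + ((l : ℂ) + 1) / r * h r)) := by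
  intro r hr
  obtain ⟨d₀, d₁⟩ := H r hr
  have hr0 : (r : ℂ) ≠ 0 := by exact_mod_cast hr.ne'
  have dinv : HasDerivAt (fun r : ℝ => ((l : ℂ) + 1) / (r : ℂ))
      (-((l : ℂ) + 1) / (r : ℂ) ^ 2) r := by
    have := ((hasDerivAt_inv hr0).comp_ofReal).const_mul ((l : ℂ) + 1)
    simp only [div_eq_mul_inv]
    refine this.congr_deriv ?_
    field_simp
  have e₀ : HasDerivAt (fun r => -h₁ r + ((l : ℂ) + 1) / r * h r)
      (ν * h r - ((l : ℂ) + 1) / r * (-h₁ r + ((l : ℂ) + 1) / r * h r)) r := by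
    refine (d₁.neg.add (dinv.mul d₀)).congr_deriv ?_
    field_simp
    ring
  refine ⟨e₀, ?_⟩
  refine ((d₀.const_mul ν).sub (dinv.mul e₀)).congr_deriv ?_
  push_cast
  field_simp
  ring

lemma raise_decay {l : ℕ} {ν : ℂ} {κ : ℝ} {h h₁ : ℝ → ℂ}
    (H : ∃ C, ∀ r : ℝ, 1 ≤ r →
      ‖h r‖ ≤ C * Real.exp (-κ * r) ∧ ‖h₁ r‖ ≤ C * Real.exp (-κ * r)) :
    ∃ C, ∀ r : ℝ, 1 ≤ r →
      ‖-h₁ r + ((l : ℂ) + 1) / r * h r‖ ≤ C * Real.exp (-κ * r) ∧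
      ‖ν * h r - ((l : ℂ) + 1) / r * (-h₁ r + ((l : ℂ) + 1) / r * h r)‖
        ≤ C * Real.exp (-κ * r) := by
  obtain ⟨C, hC⟩ := H
  have hc : ∀ r : ℝ, 1 ≤ r → ‖((l : ℂ) + 1) / (r : ℂ)‖ ≤ (l : ℝ) + 1 := by
    intro r hr
    have : ‖(l : ℂ) + 1‖ = (l : ℝ) + 1 := by
      rw [show (l : ℂ) + 1 = ((l + 1 : ℕ) : ℂ) by push_cast; rfl, Complex.norm_natCast]
      push_cast; rfl
    rw [norm_div, this, Complex.norm_real, Real.norm_of_nonneg (by linarith)]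
    exact div_le_self (by positivity) hr
  have hC0 : 0 ≤ C := by
    have := (norm_nonneg _).trans (hC 1 le_rfl).1
    exact nonneg_of_mul_nonneg_left this (Real.exp_pos _)
  refine ⟨(C + (l + 1) * C) + (‖ν‖ * C + (l + 1) * (C + (l + 1) * C)), fun r hr => ?_⟩
  obtain ⟨b₀, b₁⟩ := hC r hr
  have E := Real.exp_pos (-κ * r)
  set E' := Real.exp (-κ * r)
  have t₀ : ‖-h₁ r + ((l : ℂ) + 1) / r * h r‖ ≤ (C + (l + 1) * C) * E' := by
    refine (norm_add_le _ _).trans ?_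
    rw [norm_neg, norm_mul]
    have := mul_le_mul (hc r hr) b₀ (norm_nonneg _) (by positivity)
    linarith
  have t₁ : ‖ν * h r - ((l : ℂ) + 1) / r * (-h₁ r + ((l : ℂ) + 1) / r * h r)‖
      ≤ (‖ν‖ * C + (l + 1) * (C + (l + 1) * C)) * E' := by
    refine (norm_sub_le _ _).trans ?_
    rw [norm_mul, norm_mul]
    have := mul_le_mul (hc r hr) t₀ (norm_nonneg _) (by positivity)
    have := mul_le_mul_of_nonneg_left b₀ (norm_nonneg ν)
    linarith
  constructor
  · refine t₀.trans (mul_le_mul_of_nonneg_right ?_ E.le)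
    have : 0 ≤ ‖ν‖ * C + (l + 1) * (C + (l + 1) * C) := by positivity
    linarith
  · refine t₁.trans (mul_le_mul_of_nonneg_right ?_ E.le)
    have : 0 ≤ C + (l + 1) * C := by positivity
    linarith

lemma IsEigenPair.raise_regular {l : ℕ} {ν : ℂ} {h h₁ : ℝ → ℂ} (S : IsEigenPair l ν h h₁)
    (H : ∃ C, ∀ r : ℝ, 0 < r → r ≤ 1 → ‖h r‖ ≤ C * r ^ (l + 1) ∧ ‖h₁ r‖ ≤ C * r ^ l) :
    ∃ C, ∀ r : ℝ, 0 < r → r ≤ 1 →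
      ‖-h₁ r + ((l : ℂ) + 1) / r * h r‖ ≤ C * r ^ (l + 1 + 1) ∧
      ‖ν * h r - ((l : ℂ) + 1) / r * (-h₁ r + ((l : ℂ) + 1) / r * h r)‖ ≤ C * r ^ (l + 1) := by
  obtain ⟨C, hC⟩ := H
  have hC0 : 0 ≤ C := by
    have := (norm_nonneg _).trans (hC 1 one_pos le_rfl).1
    simpa using this
  have hn : ‖(l : ℂ) + 1‖ = (l : ℝ) + 1 := by
    rw [show (l : ℂ) + 1 = ((l + 1 : ℕ) : ℂ) by push_cast; rfl, Complex.norm_natCast]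
    push_cast; rfl
  have hnr : ∀ r : ℝ, 0 < r → ‖((l : ℂ) + 1) / (r : ℂ)‖ = ((l : ℝ) + 1) / r := by
    intro r hr
    rw [norm_div, hn, Complex.norm_real, Real.norm_of_nonneg hr.le]
  set k : ℝ → ℂ := fun r => -h₁ r + ((l : ℂ) + 1) / r * h r with hk
  -- crude bound, only used to see that `r ^ (l + 1) * k r` vanishes at `0`
  have crude : ∀ r : ℝ, 0 < r → r ≤ 1 → ‖k r‖ ≤ (C + (l + 1) * C) * r ^ l := by
    intro r hr hr1
    obtain ⟨b₀, b₁⟩ := hC r hr hr1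
    refine (norm_add_le _ _).trans ?_
    rw [norm_neg, norm_mul, hnr r hr]
    have : ((l : ℝ) + 1) / r * ‖h r‖ ≤ ((l : ℝ) + 1) / r * (C * r ^ (l + 1)) :=
      mul_le_mul_of_nonneg_left b₀ (by positivity)
    have e : ((l : ℝ) + 1) / r * (C * r ^ (l + 1)) = (l + 1) * C * r ^ l := by
      field_simp
      ring
    linarith
  have hder : ∀ r : ℝ, 0 < r →
      HasDerivAt (fun r : ℝ => (r : ℂ) ^ (l + 1) * k r) (ν * (r : ℂ) ^ (l + 1) * h r) r := by
    intro r hr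
    have hr0 : (r : ℂ) ≠ 0 := by exact_mod_cast hr.ne'
    have d := ((hasDerivAt_pow (l + 1) (r : ℂ)).comp_ofReal).mul (S.raise r hr).1
    refine d.congr_deriv ?_
    simp only [add_tsub_cancel_right, Nat.cast_add, Nat.cast_one]
    field_simp
    ring
  have main : ∀ r : ℝ, 0 < r → r ≤ 1 → ‖k r‖ ≤ ‖ν‖ * C * r ^ (l + 1 + 1) := by
    intro r hr hr1
    have step : ∀ ε : ℝ, 0 < ε → ε < r →
        ‖(r : ℂ) ^ (l + 1) * k r‖ ≤
          ‖ν‖ * C * r ^ (2 * l + 3) + (C + (l + 1) * C) * ε := by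
      intro ε hε hεr
      have mv := (convex_Icc ε r).norm_image_sub_le_of_norm_hasDerivWithin_le
        (f := fun r : ℝ => (r : ℂ) ^ (l + 1) * k r)
        (f' := fun r : ℝ => ν * (r : ℂ) ^ (l + 1) * h r) (C := ‖ν‖ * C * r ^ (2 * l + 2))
        (x := ε) (y := r)
        (fun x hx => (hder x (hε.trans_le hx.1)).hasDerivWithinAt) ?_ ⟨le_rfl, hεr.le⟩
        ⟨hεr.le, le_rfl⟩
      · have h1 : ‖(ε : ℂ) ^ (l + 1) * k ε‖ ≤ (C + (l + 1) * C) * ε := by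
          rw [norm_mul, norm_pow, Complex.norm_real, Real.norm_of_nonneg hε.le]
          have := crude ε hε (hεr.le.trans hr1)
          have p1 : ε ^ l ≤ 1 := pow_le_one₀ hε.le (hεr.le.trans hr1)
          have p2 : ε ^ (l + 1) ≤ ε := by
            rw [pow_succ]; nlinarith
          have p3 : ‖k ε‖ ≤ C + (l + 1) * C :=
            this.trans (mul_le_of_le_one_right (by positivity) p1)
          calc ε ^ (l + 1) * ‖k ε‖ ≤ ε * (C + (l + 1) * C) :=
                mul_le_mul p2 p3 (norm_nonneg _) hε.le
            _ = _ := by ring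
        have h2 : ‖r - ε‖ ≤ r := by
          rw [Real.norm_of_nonneg (by linarith)]; linarith
        have h3 : ‖ν‖ * C * r ^ (2 * l + 2) * ‖r - ε‖ ≤ ‖ν‖ * C * r ^ (2 * l + 3) := by
          calc _ ≤ ‖ν‖ * C * r ^ (2 * l + 2) * r :=
                mul_le_mul_of_nonneg_left h2 (by positivity)
            _ = _ := by ring
        have h4 := norm_sub_norm_le ((r : ℂ) ^ (l + 1) * k r) ((ε : ℂ) ^ (l + 1) * k ε)
        linarith
      · intro x hx
        have hx0 := hε.trans_le hx.1
        rw [norm_mul, norm_mul, norm_pow, Complex.norm_real, Real.norm_of_nonneg hx0.le]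
        have b₀ := (hC x hx0 (hx.2.trans hr1)).1
        calc ‖ν‖ * x ^ (l + 1) * ‖h x‖ ≤ ‖ν‖ * x ^ (l + 1) * (C * x ^ (l + 1)) :=
              mul_le_mul_of_nonneg_left b₀ (by positivity)
          _ = ‖ν‖ * C * x ^ (2 * l + 2) := by ring
          _ ≤ _ := mul_le_mul_of_nonneg_left (pow_le_pow_left₀ hx0.le hx.2 _) (by positivity)
    have lim : ‖(r : ℂ) ^ (l + 1) * k r‖ ≤ ‖ν‖ * C * r ^ (2 * l + 3) := by
      have ht : Filter.Tendsto (fun ε : ℝ => ‖ν‖ * C * r ^ (2 * l + 3) + (C + (l + 1) * C) * ε)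
          (nhdsWithin 0 (Ioi 0)) (nhds (‖ν‖ * C * r ^ (2 * l + 3) + (C + (l + 1) * C) * 0)) :=
        (Continuous.tendsto (by fun_prop) 0).mono_left nhdsWithin_le_nhds
      rw [mul_zero, add_zero] at ht
      refine ge_of_tendsto ht ?_
      filter_upwards [Ioo_mem_nhdsGT hr] with ε hε using step ε hε.1 hε.2
    rw [norm_mul, norm_pow, Complex.norm_real, Real.norm_of_nonneg hr.le] at lim
    refine le_of_mul_le_mul_left (lim.trans_eq ?_) (pow_pos hr (l + 1))
    ring
  refine ⟨‖ν‖ * C + (l + 1) * (‖ν‖ * C), fun r hr hr1 => ⟨?_, ?_⟩⟩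
  · refine (main r hr hr1).trans (mul_le_mul_of_nonneg_right ?_ (by positivity))
    have : 0 ≤ (l + 1) * (‖ν‖ * C) := by positivity
    linarith
  · refine (norm_sub_le _ _).trans ?_
    rw [norm_mul, norm_mul, hnr r hr]
    have a1 := mul_le_mul_of_nonneg_left (hC r hr hr1).1 (norm_nonneg ν)
    have a2 : ((l : ℝ) + 1) / r * ‖k r‖ ≤ ((l : ℝ) + 1) / r * (‖ν‖ * C * r ^ (l + 1 + 1)) :=
      mul_le_mul_of_nonneg_left (main r hr hr1) (by positivity)
    have e : ((l : ℝ) + 1) / r * (‖ν‖ * C * r ^ (l + 1 + 1)) =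
        (l + 1) * (‖ν‖ * C) * r ^ (l + 1) := by
      field_simp
      ring
    have : ‖-h₁ r + ((l : ℂ) + 1) / r * h r‖ = ‖k r‖ := rfl
    rw [this]
    linarith

/-- For `ν = -k²` with `Re k > 0`, the equation `T_l h = ν h` has an exponentially decaying
solution `d` and a solution `e` regular at `0`, with nonvanishing Wronskian. -/
lemma exists_fundamental_pair (k : ℂ) (hk : 0 < k.re) (l : ℕ) :
    ∃ d d₁ e e₁ : ℝ → ℂ, IsEigenPair l (-k ^ 2) d d₁ ∧ IsEigenPair l (-k ^ 2) e e₁ ∧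
      (∃ C, ∀ r : ℝ, 1 ≤ r →
        ‖d r‖ ≤ C * Real.exp (-k.re * r) ∧ ‖d₁ r‖ ≤ C * Real.exp (-k.re * r)) ∧
      (∃ C, ∀ r : ℝ, 0 < r → r ≤ 1 → ‖e r‖ ≤ C * r ^ (l + 1) ∧ ‖e₁ r‖ ≤ C * r ^ l) ∧
      ∀ r : ℝ, 0 < r → d r * e₁ r - d₁ r * e r ≠ 0 := by
  have hk0 : k ≠ 0 := by rintro rfl; simp at hk
  induction l with
  | zero =>
    have dlin : ∀ (c : ℂ) (r : ℝ), HasDerivAt (fun r : ℝ => c * (r : ℂ)) c r := by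
      intro c r
      simpa using ((hasDerivAt_id (r : ℂ)).comp_ofReal).const_mul c
    have dexp : ∀ r : ℝ, HasDerivAt (fun r : ℝ => Complex.exp (-k * r))
        (-k * Complex.exp (-k * r)) r := by
      intro r
      convert (dlin (-k) r).cexp using 1; ring
    have dsinh : ∀ r : ℝ, HasDerivAt (fun r : ℝ => Complex.sinh (k * r))
        (k * Complex.cosh (k * r)) r := by
      intro r
      refine ((Complex.hasDerivAt_sinh (k * r)).comp r (dlin k r)).congr_deriv ?_
      ring
    have dcosh : ∀ r : ℝ, HasDerivAt (fun r : ℝ => Complex.cosh (k * r))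
        (k * Complex.sinh (k * r)) r := by
      intro r
      refine ((Complex.hasDerivAt_cosh (k * r)).comp r (dlin k r)).congr_deriv ?_
      ring
    refine ⟨fun r => Complex.exp (-k * r), fun r => -k * Complex.exp (-k * r),
      fun r => Complex.sinh (k * r), fun r => k * Complex.cosh (k * r), ?_, ?_, ?_, ?_, ?_⟩
    · intro r _
      refine ⟨dexp r, ?_⟩
      refine ((dexp r).const_mul (-k)).congr_deriv ?_
      simp; ring
    · intro r _
      refine ⟨dsinh r, ?_⟩
      refine ((dcosh r).const_mul k).congr_deriv ?_
      simp; ring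
    · refine ⟨1 + ‖k‖, fun r _ => ?_⟩
      have e : ‖Complex.exp (-k * r)‖ = Real.exp (-k.re * r) := by
        rw [Complex.norm_exp]; simp
      have E := Real.exp_pos (-k.re * r)
      have := norm_nonneg k
      rw [norm_mul, norm_neg, e]
      constructor <;> nlinarith
    · obtain ⟨C, hC⟩ := (isCompact_Icc (a := (0 : ℝ)) (b := 1)).exists_bound_of_continuousOn
        (f := fun r : ℝ => k * Complex.cosh (k * r)) (by fun_prop)
      refine ⟨C, fun r hr hr1 => ⟨?_, by simpa using hC r ⟨hr.le, hr1⟩⟩⟩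
      have := (convex_Icc (0 : ℝ) 1).norm_image_sub_le_of_norm_hasDerivWithin_le
        (fun x _ => (dsinh x).hasDerivWithinAt) hC (x := 0) (y := r) ⟨le_rfl, zero_le_one⟩
        ⟨hr.le, hr1⟩
      simpa [abs_of_pos hr] using this
    · intro r _
      have : Complex.exp (-k * r) * (k * Complex.cosh (k * r)) -
          -k * Complex.exp (-k * r) * Complex.sinh (k * r) = k := by
        have h1 := Complex.cosh_add_sinh (k * r)
        have h2 : Complex.exp (-k * r) * Complex.exp (k * r) = 1 := by
          rw [← Complex.exp_add]; simp
        calc _ = k * Complex.exp (-k * r) * (Complex.cosh (k * r) + Complex.sinh (k * r)) := by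
              ring
          _ = k * (Complex.exp (-k * r) * Complex.exp (k * r)) := by rw [h1]; ring
          _ = k := by rw [h2, mul_one]
      rw [this]; exact hk0
  | succ l ih =>
    obtain ⟨d, d₁, e, e₁, Sd, Se, Bd, Be, W⟩ := ih
    refine ⟨_, _, _, _, Sd.raise, Se.raise, raise_decay Bd, Se.raise_regular Be, ?_⟩
    intro r hr
    have : -k ^ 2 * (d r * e₁ r - d₁ r * e r) ≠ 0 :=
      mul_ne_zero (neg_ne_zero.mpr (pow_ne_zero 2 hk0)) (W r hr)
    convert this using 1
    ring

lemma IsEigenPair.continuousOn {l : ℕ} {ν : ℂ} {h h₁ : ℝ → ℂ} (H : IsEigenPair l ν h h₁) :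
    ContinuousOn h (Ioi 0) ∧ ContinuousOn h₁ (Ioi 0) :=
  ⟨fun r hr => (H r hr).1.continuousAt.continuousWithinAt,
    fun r hr => (H r hr).2.continuousAt.continuousWithinAt⟩

/-- `∫ ‖g‖ ‖z‖` over an interval of length `|δ|`, with `‖z‖ ≤ K` and `g` square integrable. -/
lemma norm_integral_mul_le_of_sq_integrable {g z : ℝ → ℂ}
    (hL2 : IntegrableOn (fun r => ‖g r‖ ^ 2) (Ioi 0)) {a b K : ℝ} (ha : 0 < a) (hb : 0 < b)
    (hab : a ≠ b) (hgz : ContinuousOn (fun r => g r * z r) (uIcc a b))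
    (hz : ∀ r ∈ uIcc a b, ‖z r‖ ≤ K) :
    ‖∫ r in a..b, g r * z r‖ ≤ K * (√|b - a| * (1 + ∫ r in Ioi 0, ‖g r‖ ^ 2) / 2) := by
  have hK : 0 ≤ K := (norm_nonneg _).trans (hz a left_mem_uIcc)
  have hσ : 0 < √|b - a| := Real.sqrt_pos.mpr (abs_pos.mpr (sub_ne_zero.mpr hab.symm))
  have hσ2 : √|b - a| ^ 2 = |b - a| := Real.sq_sqrt (abs_nonneg _)
  set σ := √|b - a|
  have hsub : uIoc a b ⊆ Ioi 0 := fun x hx => (lt_min ha hb).trans hx.1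
  have hsub' : uIoc a b ⊆ uIcc a b := uIoc_subset_uIcc
  have hi : IntegrableOn (fun r => ‖g r‖ ^ 2) (uIoc a b) := hL2.mono_set hsub
  have hc : IntegrableOn (fun _ : ℝ => K / (2 * σ)) (uIoc a b) := by
    rw [integrableOn_const_iff]; right; simp [uIoc]
  have hbd : IntegrableOn (fun r => K / (2 * σ) + K * σ / 2 * ‖g r‖ ^ 2) (uIoc a b) :=
    hc.add (hi.const_mul _)
  have hgzi : IntegrableOn (fun r => ‖g r * z r‖) (uIoc a b) :=
    ((hgz.integrableOn_compact isCompact_uIcc).mono_set hsub').norm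
  calc ‖∫ r in a..b, g r * z r‖ ≤ ∫ r in uIoc a b, ‖g r * z r‖ :=
        intervalIntegral.norm_integral_le_integral_norm_uIoc
    _ ≤ ∫ r in uIoc a b, (K / (2 * σ) + K * σ / 2 * ‖g r‖ ^ 2) := by
        refine setIntegral_mono_on hgzi hbd measurableSet_uIoc fun r hr => ?_
        rw [norm_mul]
        have h1 := mul_le_mul_of_nonneg_left (hz r (hsub' hr)) (norm_nonneg (g r))
        have h2 : ‖g r‖ ≤ 1 / (2 * σ) + σ / 2 * ‖g r‖ ^ 2 := by
          have : 1 / (2 * σ) + σ / 2 * ‖g r‖ ^ 2 - ‖g r‖ = (1 - σ * ‖g r‖) ^ 2 / (2 * σ) := by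
            field_simp; ring
          have : 0 ≤ (1 - σ * ‖g r‖) ^ 2 / (2 * σ) := by positivity
          linarith
        have h3 := mul_le_mul_of_nonneg_right h2 hK
        have e : (1 / (2 * σ) + σ / 2 * ‖g r‖ ^ 2) * K = K / (2 * σ) + K * σ / 2 * ‖g r‖ ^ 2 := by
          ring
        linarith
    _ = K / (2 * σ) * σ ^ 2 + K * σ / 2 * ∫ r in uIoc a b, ‖g r‖ ^ 2 := by
        have hvol : (volume : Measure ℝ).real (uIoc a b) = |b - a| := by
          rw [Measure.real, uIoc, Real.volume_Ioc, max_sub_min_eq_abs', abs_sub_comm]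
          exact ENNReal.toReal_ofReal (abs_nonneg _)
        rw [integral_add hc (hi.const_mul _), integral_const_mul, setIntegral_const, hvol, hσ2,
          smul_eq_mul, mul_comm]
    _ ≤ K / (2 * σ) * σ ^ 2 + K * σ / 2 * ∫ r in Ioi 0, ‖g r‖ ^ 2 := by
        gcongr
        exact Filter.Eventually.of_forall fun r => by positivity
    _ = K * (σ * (1 + ∫ r in Ioi 0, ‖g r‖ ^ 2) / 2) := by
        field_simp

/-- Testing `u = T_l g + ν g`, where `T_l u = ν u`, against a cut-off solution `h` bounds the
Wronskian of `u` and `h` by the size of `h` and the `L²` norm of `g` only. -/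
lemma exists_wronskian_bound {l : ℕ} {ν : ℂ} {g g₁ u u₁ h h₁ : ℝ → ℂ}
    (dg : ∀ r : ℝ, 0 < r → HasDerivAt g (g₁ r) r)
    (dg₁ : ∀ r : ℝ, 0 < r →
      HasDerivAt g₁ (((l : ℂ) * ((l : ℂ) + 1) / (r : ℂ) ^ 2 + ν) * g r - u r) r)
    (Su : IsEigenPair l ν u u₁) (Sh : IsEigenPair l ν h h₁)
    (hL2 : IntegrableOn (fun r => ‖g r‖ ^ 2) (Ioi 0)) :
    ∃ D : ℝ, ∀ a δ B : ℝ, 0 < a → 0 < a + δ → δ ≠ 0 → |δ| ≤ 1 →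
      (∀ r ∈ uIcc a (a + δ), |δ| ≤ r ∧ ‖h r‖ ≤ B * |δ| ^ 4 ∧ ‖h₁ r‖ ≤ B * |δ| ^ 3) →
      ‖u (a + δ) * h₁ (a + δ) - u₁ (a + δ) * h (a + δ)‖ ≤ D * B * √|δ| := by
  obtain ⟨p₀, p₁, p₂, p₃, p₄, P, d₀, d₁, d₂, d₃, c₄, ⟨z₀, z₁, z₂, z₃⟩, ⟨o₀, o₁, o₂, o₃⟩, hP, bP⟩ :=
    exists_smooth_step
  set L : ℂ := (l : ℂ) * ((l : ℂ) + 1) with hL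
  refine ⟨P * (5 + 8 * ‖L‖ + 10 * ‖ν‖) * ((1 + ∫ r in Ioi 0, ‖g r‖ ^ 2) / 2), ?_⟩
  intro a δ B ha hb hδ hδ1 hB
  have hδC : (δ : ℂ) ≠ 0 := by exact_mod_cast hδ
  have hδa : 0 < |δ| := abs_pos.mpr hδ
  have hpos : ∀ r ∈ uIcc a (a + δ), 0 < r := fun r hr => hδa.trans_le (hB r hr).1
  let t : ℝ → ℝ := fun r => (r - a) / δ
  have ht : ∀ r, HasDerivAt t δ⁻¹ r := by
    intro r
    simpa [t] using ((hasDerivAt_id r).sub_const a).div_const δ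
  have htc : Continuous t := by fun_prop
  have hcomp : ∀ (n : ℕ) (p q : ℝ → ℂ), (∀ t, HasDerivAt p (q t) t) → ∀ r,
      HasDerivAt (fun r => p (t r) / (δ : ℂ) ^ n) (q (t r) / (δ : ℂ) ^ (n + 1)) r := by
    intro n p q hpq r
    refine (((hpq (t r)).scomp r (ht r)).div_const ((δ : ℂ) ^ n)).congr_deriv ?_
    rw [Complex.real_smul, Complex.ofReal_inv]
    field_simp
    ring
  let φ : ℝ → ℂ := fun r => p₀ (t r) / (δ : ℂ) ^ 0
  let φ₁ : ℝ → ℂ := fun r => p₁ (t r) / (δ : ℂ) ^ 1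
  let φ₂ : ℝ → ℂ := fun r => p₂ (t r) / (δ : ℂ) ^ 2
  let φ₃ : ℝ → ℂ := fun r => p₃ (t r) / (δ : ℂ) ^ 3
  let φ₄ : ℝ → ℂ := fun r => p₄ (t r) / (δ : ℂ) ^ 4
  have e₀ : ∀ r, HasDerivAt φ (φ₁ r) r := hcomp 0 p₀ p₁ d₀
  have e₁ : ∀ r, HasDerivAt φ₁ (φ₂ r) r := hcomp 1 p₁ p₂ d₁
  have e₂ : ∀ r, HasDerivAt φ₂ (φ₃ r) r := hcomp 2 p₂ p₃ d₂
  have e₃ : ∀ r, HasDerivAt φ₃ (φ₄ r) r := hcomp 3 p₃ p₄ d₃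
  let q : ℝ → ℂ := fun r => L / (r : ℂ) ^ 2 - ν
  let q₁ : ℝ → ℂ := fun r => -2 * L / (r : ℂ) ^ 3
  have dq : ∀ r : ℝ, 0 < r → HasDerivAt q (q₁ r) r := by
    intro r hr
    have hr0 : (r : ℂ) ≠ 0 := by exact_mod_cast hr.ne'
    have := (((((hasDerivAt_pow 2 (r : ℂ)).inv (pow_ne_zero 2 hr0)).comp_ofReal).const_mul
      L).sub_const ν)
    refine this.congr_deriv ?_
    simp only [q₁]
    field_simp
    ring
  let G : ℝ → ℂ := fun r => u r * (φ₁ r * h r + φ r * h₁ r) - u₁ r * (φ r * h r)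
    + g₁ r * (φ₂ r * h r + 2 * (φ₁ r * h₁ r))
    - g r * (φ₃ r * h r + 3 * (φ₂ r * h₁ r) + 2 * (φ₁ r * (q r * h r)))
  let z : ℝ → ℂ := fun r => φ₄ r * h r + 4 * φ₃ r * h₁ r + (4 * q r - 2 * ν) * φ₂ r * h r
    + 2 * φ₁ r * q₁ r * h r - 4 * ν * φ₁ r * h₁ r
  have dG : ∀ r : ℝ, 0 < r → HasDerivAt G (-(g r * z r)) r := by
    intro r hr
    obtain ⟨u0, u1⟩ := Su r hr
    obtain ⟨h0, h1⟩ := Sh r hr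
    have := (((u0.mul (((e₁ r).mul h0).add ((e₀ r).mul h1))).sub (u1.mul ((e₀ r).mul h0))).add
      ((dg₁ r hr).mul (((e₂ r).mul h0).add (((e₁ r).mul h1).const_mul 2)))).sub
      ((dg r hr).mul ((((e₃ r).mul h0).add (((e₂ r).mul h1).const_mul 3)).add
        (((e₁ r).mul ((dq r hr).mul h0)).const_mul 2)))
    refine this.congr_deriv ?_
    simp only [z, q, Pi.mul_apply, Pi.add_apply]
    ring
  have hsub : uIcc a (a + δ) ⊆ Ioi 0 := hpos
  have cg : ContinuousOn g (uIcc a (a + δ)) := fun r hr =>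
    (dg r (hpos r hr)).continuousAt.continuousWithinAt
  have ch := Sh.continuousOn.1.mono hsub
  have ch₁ := Sh.continuousOn.2.mono hsub
  have cq : ContinuousOn q (uIcc a (a + δ)) := fun r hr =>
    (dq r (hpos r hr)).continuousAt.continuousWithinAt
  have cq₁ : ContinuousOn q₁ (uIcc a (a + δ)) := by
    refine ContinuousOn.div (by fun_prop) (by fun_prop) fun r hr => ?_
    exact pow_ne_zero 3 (by exact_mod_cast (hpos r hr).ne')
  have cφ₁ : ContinuousOn φ₁ (uIcc a (a + δ)) := fun r _ =>
    (e₁ r).continuousAt.continuousWithinAt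
  have cφ₂ : ContinuousOn φ₂ (uIcc a (a + δ)) := fun r _ =>
    (e₂ r).continuousAt.continuousWithinAt
  have cφ₃ : ContinuousOn φ₃ (uIcc a (a + δ)) := fun r _ =>
    (e₃ r).continuousAt.continuousWithinAt
  have cφ₄ : ContinuousOn φ₄ (uIcc a (a + δ)) :=
    ((c₄.comp htc).div_const _).continuousOn
  have cgz : ContinuousOn (fun r => g r * z r) (uIcc a (a + δ)) := by
    simp only [z]; fun_prop
  have ftc := intervalIntegral.integral_eq_sub_of_hasDerivAt
    (fun r hr => dG r (hpos r hr)) cgz.neg.intervalIntegrable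
  have ta : t a = 0 := by simp [t]
  have tb : t (a + δ) = 1 := by simp [t, hδ]
  have Ga : G a = 0 := by simp [G, φ, φ₁, φ₂, φ₃, ta, z₀, z₁, z₂, z₃]
  have Gb : G (a + δ) = u (a + δ) * h₁ (a + δ) - u₁ (a + δ) * h (a + δ) := by
    simp [G, φ, φ₁, φ₂, φ₃, tb, o₀, o₁, o₂, o₃]
  have hz : ∀ r ∈ uIcc a (a + δ), ‖z r‖ ≤ P * (5 + 8 * ‖L‖ + 10 * ‖ν‖) * B := by
    intro r hr
    obtain ⟨hδr, bh, bh₁⟩ := hB r hr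
    have hr0 := hpos r hr
    have htr : t r ∈ Icc (0 : ℝ) 1 := by
      rcases lt_or_gt_of_ne hδ with hn | hp
      · rw [uIcc_of_ge (by linarith)] at hr
        constructor
        · exact div_nonneg_of_nonpos (by linarith [hr.2]) hn.le
        · rw [div_le_one_of_neg hn]; linarith [hr.1]
      · rw [uIcc_of_le (by linarith)] at hr
        constructor
        · exact div_nonneg (by linarith [hr.1]) hp.le
        · rw [div_le_one hp]; linarith [hr.2]
    obtain ⟨b₁, b₂, b₃, b₄⟩ := bP _ htr
    set ε := |δ| with hε
    have nφ : ∀ (n : ℕ) (w : ℂ), ‖w‖ ≤ P → ‖w / (δ : ℂ) ^ n‖ ≤ P / ε ^ n := by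
      intro n w hw
      rw [norm_div, norm_pow, Complex.norm_real, Real.norm_eq_abs, ← hε]
      gcongr
    have n₁ : ‖φ₁ r‖ ≤ P / ε ^ 1 := nφ 1 _ b₁
    have n₂ : ‖φ₂ r‖ ≤ P / ε ^ 2 := nφ 2 _ b₂
    have n₃ : ‖φ₃ r‖ ≤ P / ε ^ 3 := nφ 3 _ b₃
    have n₄ : ‖φ₄ r‖ ≤ P / ε ^ 4 := nφ 4 _ b₄
    have hB0 : 0 ≤ B :=
      nonneg_of_mul_nonneg_left ((norm_nonneg _).trans bh) (pow_pos hδa 4)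
    have nq : ‖4 * q r - 2 * ν‖ ≤ (4 * ‖L‖ + 6 * ‖ν‖) / ε ^ 2 := by
      have h1 : 4 * q r - 2 * ν = 4 * (L / (r : ℂ) ^ 2) - 6 * ν := by simp only [q]; ring
      have h2 : ‖L / (r : ℂ) ^ 2‖ ≤ ‖L‖ / ε ^ 2 := by
        rw [norm_div, norm_pow, Complex.norm_real, Real.norm_of_nonneg hr0.le]
        gcongr
      have h3 : ‖ν‖ ≤ ‖ν‖ / ε ^ 2 :=
        le_div_self (norm_nonneg _) (pow_pos hδa 2) (pow_le_one₀ hδa.le hδ1)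
      rw [h1]
      refine (norm_sub_le _ _).trans ?_
      have n4 : ‖(4 : ℂ)‖ = 4 := by norm_num
      have n6 : ‖(6 : ℂ)‖ = 6 := by norm_num
      rw [norm_mul, norm_mul, add_div, mul_div_assoc 4 ‖L‖, mul_div_assoc 6 ‖ν‖, n4, n6]
      linarith
    have nq₁ : ‖q₁ r‖ ≤ 2 * ‖L‖ / ε ^ 3 := by
      simp only [q₁]
      rw [norm_div, norm_pow, Complex.norm_real, Real.norm_of_nonneg hr0.le, norm_mul, norm_neg]
      norm_num
      gcongr
    have hε1 : ε * ε ≤ 1 := by nlinarith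
    have hL0 := norm_nonneg L
    have hν0 := norm_nonneg ν
    have m₁ : ‖φ₄ r * h r‖ ≤ P * B := by
      rw [norm_mul]
      refine (mul_le_mul n₄ bh (norm_nonneg _) (by positivity)).trans_eq ?_
      field_simp
    have m₂ : ‖4 * φ₃ r * h₁ r‖ ≤ 4 * (P * B) := by
      rw [mul_assoc, norm_mul, norm_mul]
      have := mul_le_mul n₃ bh₁ (norm_nonneg _) (by positivity)
      have e : P / ε ^ 3 * (B * ε ^ 3) = P * B := by field_simp
      norm_num
      linarith
    have m₃ : ‖(4 * q r - 2 * ν) * φ₂ r * h r‖ ≤ (4 * ‖L‖ + 6 * ‖ν‖) * (P * B) := by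
      rw [norm_mul, norm_mul]
      refine (mul_le_mul (mul_le_mul nq n₂ (norm_nonneg _) (by positivity)) bh (norm_nonneg _)
        (by positivity)).trans_eq ?_
      field_simp
    have m₄ : ‖2 * φ₁ r * q₁ r * h r‖ ≤ 4 * ‖L‖ * (P * B) := by
      rw [mul_assoc 2, mul_assoc 2, norm_mul, norm_mul, norm_mul]
      have := mul_le_mul (mul_le_mul n₁ nq₁ (norm_nonneg _) (by positivity)) bh (norm_nonneg _)
        (by positivity)
      have e : P / ε ^ 1 * (2 * ‖L‖ / ε ^ 3) * (B * ε ^ 4) = 2 * ‖L‖ * (P * B) := by field_simp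
      norm_num
      linarith
    have m₅ : ‖4 * ν * φ₁ r * h₁ r‖ ≤ 4 * ‖ν‖ * (P * B) := by
      rw [mul_assoc (4 * ν), norm_mul, norm_mul, norm_mul]
      have := mul_le_mul n₁ bh₁ (norm_nonneg _) (by positivity)
      have e : P / ε ^ 1 * (B * ε ^ 3) = P * B * (ε * ε) := by field_simp
      have e' : P * B * (ε * ε) ≤ P * B := mul_le_of_le_one_right (by positivity) hε1
      norm_num
      exact mul_le_mul_of_nonneg_left (by linarith) (by positivity)
    calc ‖z r‖ ≤ ‖φ₄ r * h r‖ + ‖4 * φ₃ r * h₁ r‖ + ‖(4 * q r - 2 * ν) * φ₂ r * h r‖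
          + ‖2 * φ₁ r * q₁ r * h r‖ + ‖4 * ν * φ₁ r * h₁ r‖ := by
          refine (norm_sub_le _ _).trans (add_le_add_left ?_ _)
          refine (norm_add_le _ _).trans (add_le_add_left ?_ _)
          refine (norm_add_le _ _).trans (add_le_add_left ?_ _)
          exact norm_add_le _ _
      _ ≤ P * B + 4 * (P * B) + (4 * ‖L‖ + 6 * ‖ν‖) * (P * B) + 4 * ‖L‖ * (P * B)
          + 4 * ‖ν‖ * (P * B) := by gcongr
      _ = _ := by ring
  have fin := norm_integral_mul_le_of_sq_integrable hL2 ha hb (by simpa using hδ) cgz hz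
  rw [intervalIntegral.integral_neg, Ga, sub_zero, Gb] at ftc
  rw [← ftc, norm_neg]
  refine fin.trans_eq ?_
  rw [add_sub_cancel_left]
  ring

lemma wronskian_const {l : ℕ} {ν : ℂ} {u u₁ h h₁ : ℝ → ℂ}
    (Su : IsEigenPair l ν u u₁) (Sh : IsEigenPair l ν h h₁) {r s : ℝ} (hr : 0 < r) (hs : 0 < s) :
    u r * h₁ r - u₁ r * h r = u s * h₁ s - u₁ s * h s := by
  have d : ∀ x ∈ Ioi (0 : ℝ), HasDerivWithinAt (fun x => u x * h₁ x - u₁ x * h x) 0 (Ioi 0) x := by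
    intro x hx
    obtain ⟨a, b⟩ := Su x hx
    obtain ⟨c, d⟩ := Sh x hx
    refine (((a.mul d).sub (b.mul c)).congr_deriv ?_).hasDerivWithinAt
    ring
  have := (convex_Ioi (0 : ℝ)).norm_image_sub_le_of_norm_hasDerivWithin_le (C := 0) d
    (fun x _ => by simp) hs hr
  simpa [sub_eq_zero] using this

/-- If `g` is square integrable, `u = T_l g + ν g`, `T_l u = ν u`, where `ν = -k²` with
`Re k > 0`, then `u` vanishes. -/
lemma eigenfunction_eq_zero {l : ℕ} (hl : 3 ≤ l) {k : ℂ} (hk : 0 < k.re) {g g₁ u u₁ : ℝ → ℂ}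
    (dg : ∀ r : ℝ, 0 < r → HasDerivAt g (g₁ r) r)
    (dg₁ : ∀ r : ℝ, 0 < r →
      HasDerivAt g₁ (((l : ℂ) * ((l : ℂ) + 1) / (r : ℂ) ^ 2 + -k ^ 2) * g r - u r) r)
    (Su : IsEigenPair l (-k ^ 2) u u₁)
    (hL2 : IntegrableOn (fun r => ‖g r‖ ^ 2) (Ioi 0)) {r : ℝ} (hr : 0 < r) : u r = 0 := by
  obtain ⟨d, d₁, e, e₁, Sd, Se, ⟨C, hC⟩, ⟨C', hC'⟩, W⟩ := exists_fundamental_pair k hk l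
  have Wd : u r * d₁ r - u₁ r * d r = 0 := by
    obtain ⟨D, hD⟩ := exists_wronskian_bound dg dg₁ Su Sd hL2
    have key : ∀ R : ℝ, 1 ≤ R →
        ‖u r * d₁ r - u₁ r * d r‖ ≤ D * (C * Real.exp (-k.re * R)) := by
      intro R hR
      have hC0 : 0 ≤ C := nonneg_of_mul_nonneg_left ((norm_nonneg _).trans (hC 1 le_rfl).1)
        (Real.exp_pos _)
      have := hD (R + 1) (-1) (C * Real.exp (-k.re * R)) (by linarith) (by linarith) (by norm_num)
        (by norm_num) ?_
      · rw [wronskian_const Su Sd hr (show 0 < R by linarith)]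
        simpa using this
      · intro x hx
        rw [uIcc_of_ge (by linarith)] at hx
        have hxR : R ≤ x := by linarith [hx.1]
        obtain ⟨b₀, b₁⟩ := hC x (hR.trans hxR)
        have : C * Real.exp (-k.re * x) ≤ C * Real.exp (-k.re * R) := by
          gcongr C * Real.exp ?_
          nlinarith
        norm_num
        exact ⟨hR.trans hxR, b₀.trans (by simpa using this), b₁.trans (by simpa using this)⟩
    have lim : Filter.Tendsto (fun R : ℝ => D * (C * Real.exp (-k.re * R))) Filter.atTop
        (nhds (D * (C * 0))) := by
      refine ((Real.tendsto_exp_atBot.comp ?_).const_mul C).const_mul D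
      exact Filter.tendsto_id.const_mul_atTop_of_neg (by linarith)
    rw [mul_zero, mul_zero] at lim
    refine norm_le_zero_iff.mp (ge_of_tendsto lim ?_)
    filter_upwards [Filter.eventually_ge_atTop 1] with R hR using key R hR
  have We : u r * e₁ r - u₁ r * e r = 0 := by
    obtain ⟨D, hD⟩ := exists_wronskian_bound dg dg₁ Su Se hL2
    have hC0 : 0 ≤ C' := by simpa using (norm_nonneg _).trans (hC' 1 one_pos le_rfl).1
    have key : ∀ ε : ℝ, 0 < ε → ε < 1 / 2 →
        ‖u r * e₁ r - u₁ r * e r‖ ≤ D * (16 * C') * √ε := by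
      intro ε hε hε1
      have := hD ε ε (16 * C') hε (by linarith) hε.ne' (by rw [abs_of_pos hε]; linarith) ?_
      · rw [wronskian_const Su Se hr (show 0 < ε + ε by linarith)]
        simpa [abs_of_pos hε] using this
      · intro x hx
        rw [uIcc_of_le (by linarith)] at hx
        have hx0 : 0 < x := hε.trans_le hx.1
        have hx1 : x ≤ 1 := by linarith [hx.2]
        obtain ⟨b₀, b₁⟩ := hC' x hx0 hx1
        rw [abs_of_pos hε]
        have x2 : x ≤ 2 * ε := by linarith [hx.2]
        refine ⟨hx.1, b₀.trans ?_, b₁.trans ?_⟩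
        · calc C' * x ^ (l + 1) ≤ C' * x ^ 4 :=
                mul_le_mul_of_nonneg_left (pow_le_pow_of_le_one hx0.le hx1 (by omega)) hC0
            _ ≤ C' * (2 * ε) ^ 4 := by gcongr
            _ = 16 * C' * ε ^ 4 := by ring
        · calc C' * x ^ l ≤ C' * x ^ 3 :=
                mul_le_mul_of_nonneg_left (pow_le_pow_of_le_one hx0.le hx1 (by omega)) hC0
            _ ≤ C' * (2 * ε) ^ 3 := by gcongr
            _ = 8 * C' * ε ^ 3 := by ring
            _ ≤ 16 * C' * ε ^ 3 := by gcongr; norm_num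
    have lim : Filter.Tendsto (fun ε : ℝ => D * (16 * C') * √ε) (nhdsWithin 0 (Ioi 0))
        (nhds (D * (16 * C') * √0)) :=
      (Continuous.tendsto (by fun_prop) 0).mono_left nhdsWithin_le_nhds
    rw [Real.sqrt_zero, mul_zero] at lim
    refine norm_le_zero_iff.mp (ge_of_tendsto lim ?_)
    filter_upwards [Ioo_mem_nhdsGT (show (0 : ℝ) < 1 / 2 by norm_num)] with ε hε
      using key ε hε.1 hε.2
  have : u r * (d r * e₁ r - d₁ r * e r) = 0 := by
    linear_combination d r * We - e r * Wd
  exact (mul_eq_zero.mp this).resolve_right (W r hr)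

/-- A square root of `-ν` with positive real part, for `ν² = i ρ⁴`. -/
lemma exists_sqrt_neg_of_sq_eq {ν : ℂ} {ρ : ℝ} (hρ : 0 < ρ)
    (hν : ν ^ 2 = Complex.I * (ρ : ℂ) ^ 4) : ∃ k : ℂ, 0 < k.re ∧ ν = -k ^ 2 := by
  obtain ⟨k, hk⟩ := IsAlgClosed.exists_pow_nat_eq (-ν) (n := 2) two_pos
  have hre : k.re ≠ 0 := by
    intro h0
    have h4 : k ^ 4 = Complex.I * (ρ : ℂ) ^ 4 := by
      rw [← hν, show k ^ 4 = (k ^ 2) ^ 2 by ring, hk]; ring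
    have hki : k = (k.im : ℂ) * Complex.I := by
      apply Complex.ext <;> simp [h0]
    have h5 : k ^ 4 = ((k.im ^ 4 : ℝ) : ℂ) := by
      rw [hki, mul_pow, Complex.I_pow_four]; simp
    have him := congrArg Complex.im h4
    rw [h5, Complex.ofReal_im, ← Complex.ofReal_pow, Complex.im_mul_ofReal, Complex.I_im,
      one_mul] at him
    exact (pow_pos hρ 4).ne him
  rcases lt_or_gt_of_ne hre with h | h
  · exact ⟨-k, by simpa using h, by rw [neg_sq, hk, neg_neg]⟩
  · exact ⟨k, h, by rw [hk, neg_neg]⟩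

/-- For `l ≥ 3`, any four times differentiable square-integrable solution of
`T_l² g = i ρ⁴ g` on `(0,∞)` vanishes identically; hence `T_l²` has deficiency
indices `(0,0)` for `l ≥ 3`. -/
theorem stmt7 (l : ℕ) (hl : 3 ≤ l) (ρ : ℝ) (hρ : 0 < ρ) (g : ℝ → ℂ)
    (hg1 : ∀ r ∈ Ioi (0 : ℝ), DifferentiableAt ℝ g r)
    (hg2 : ∀ r ∈ Ioi (0 : ℝ), DifferentiableAt ℝ (deriv g) r)
    (hg3 : ∀ r ∈ Ioi (0 : ℝ), DifferentiableAt ℝ (deriv (deriv g)) r)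
    (hg4 : ∀ r ∈ Ioi (0 : ℝ), DifferentiableAt ℝ (deriv (deriv (deriv g))) r)
    (heq : ∀ r ∈ Ioi (0 : ℝ), Tl l (Tl l g) r = Complex.I * (ρ : ℂ) ^ 4 * g r)
    (hL2 : IntegrableOn (fun r => ‖g r‖ ^ 2) (Ioi 0)) :
    ∀ r ∈ Ioi (0 : ℝ), g r = 0 := by
  have heq' : ∀ r ∈ Ioi (0 : ℝ), deriv (deriv (Tl l g)) r =
      (l : ℂ) * ((l : ℂ) + 1) / (r : ℂ) ^ 2 * Tl l g r - Complex.I * (ρ : ℂ) ^ 4 * g r := by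
    intro r hr
    rw [← heq r hr]
    change _ = _ - (-(deriv (deriv (Tl l g)) r) + _)
    ring
  have hg'' : ∀ r, deriv (deriv g) r =
      (l : ℂ) * ((l : ℂ) + 1) / (r : ℂ) ^ 2 * g r - Tl l g r := by
    intro r
    rw [Tl]
    ring
  have hT : ∀ r ∈ Ioi (0 : ℝ), HasDerivAt (Tl l g) (-(deriv (deriv (deriv g)) r) +
      ((l : ℂ) * ((l : ℂ) + 1)) * (deriv g r / (r : ℂ) ^ 2 - 2 * g r / (r : ℂ) ^ 3)) r := by
    intro r hr
    have hr0 : (r : ℂ) ≠ 0 := by exact_mod_cast (ne_of_gt hr)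
    have := (hg3 r hr).hasDerivAt.neg.add (((hg1 r hr).hasDerivAt.const_mul
      ((l : ℂ) * ((l : ℂ) + 1))).div ((hasDerivAt_pow 2 (r : ℂ)).comp_ofReal) (pow_ne_zero 2 hr0))
    refine this.congr_deriv ?_
    field_simp
    ring
  have hT' : ∀ r ∈ Ioi (0 : ℝ), DifferentiableAt ℝ (deriv (Tl l g)) r := by
    intro r hr
    have hr0 : (r : ℂ) ≠ 0 := by exact_mod_cast (ne_of_gt hr)
    have ev : deriv (Tl l g) =ᶠ[nhds r] fun r => -(deriv (deriv (deriv g)) r) +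
        ((l : ℂ) * ((l : ℂ) + 1)) * (deriv g r / (r : ℂ) ^ 2 - 2 * g r / (r : ℂ) ^ 3) := by
      filter_upwards [isOpen_Ioi.mem_nhds hr] with x hx using (hT x hx).deriv
    refine DifferentiableAt.congr_of_eventuallyEq ?_ ev
    have dr : ∀ n : ℕ, DifferentiableAt ℝ (fun r : ℝ => (r : ℂ) ^ n) r := fun n =>
      ((hasDerivAt_pow n (r : ℂ)).comp_ofReal).differentiableAt
    exact (hg4 r hr).neg.add ((((hg2 r hr).div (dr 2) (pow_ne_zero 2 hr0)).sub
      (((hg1 r hr).const_mul 2).div (dr 3) (pow_ne_zero 3 hr0))).const_mul _)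
  have main : ∀ ν : ℂ, ν ^ 2 = Complex.I * (ρ : ℂ) ^ 4 → ∀ r ∈ Ioi (0 : ℝ),
      Tl l g r + ν * g r = 0 := by
    intro ν hν r hr
    obtain ⟨k, hk, rfl⟩ := exists_sqrt_neg_of_sq_eq hρ hν
    refine eigenfunction_eq_zero hl hk (g := g) (g₁ := deriv g)
      (u := fun r => Tl l g r + -k ^ 2 * g r) (u₁ := fun r => deriv (Tl l g) r + -k ^ 2 * deriv g r)
      (fun x hx => (hg1 x hx).hasDerivAt) (fun x hx => ?_) (fun x hx => ⟨?_, ?_⟩) hL2 hr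
    · refine (hg2 x hx).hasDerivAt.congr_deriv ?_
      rw [hg'']
      ring
    · exact (hT x hx).differentiableAt.hasDerivAt.add ((hg1 x hx).hasDerivAt.const_mul _)
    · refine ((hT' x hx).hasDerivAt.add ((hg2 x hx).hasDerivAt.const_mul _)).congr_deriv ?_
      rw [heq' x hx, hg'', ← hν]
      ring
  obtain ⟨μ, hμ⟩ := IsAlgClosed.exists_pow_nat_eq (Complex.I * (ρ : ℂ) ^ 4) (n := 2) two_pos
  intro r hr
  have h1 := main μ hμ r hr
  have h2 := main (-μ) (by rw [neg_sq, hμ]) r hr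
  have hμ0 : μ ≠ 0 := by
    rintro rfl
    have hρC : (ρ : ℂ) ≠ 0 := by exact_mod_cast hρ.ne'
    exact mul_ne_zero Complex.I_ne_zero (pow_ne_zero 4 hρC) (by simpa using hμ.symm)
  have h3 : μ * g r = 0 := by linear_combination (h1 - h2) / 2
  exact (mul_eq_zero.mp h3).resolve_left hμ0
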